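/- Let n ≥ 3 be an integer and v > 0 a real number. There exist γ_0, γ_1, …, γ_n ∈ Φ(n,v) such that det(γ_0, γ_1, …, γ_n) = v − v^{−1}. -/

import Mathlib

/-- The quantum integer `c_k`: `(v^k - v^(-k))/(v - v⁻¹)` if `v ≠ 1`, and `k` if `v = 1`. -/
noncomputable def qint (v : ℝ) (k : ℤ) : ℝ :=
  if v = 1 then (k : ℝ) else (v ^ k - v ^ (-k)) / (v - v⁻¹)

/-- The root `α_{i,j} = α_i + α_{i+1} + ⋯ + α_j` in coordinates. -/
noncomputable def alphaIJ (n i j : ℕ) : Fin (n + 1) → ℝ :=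
  fun l => if i ≤ (l : ℕ) ∧ (l : ℕ) ≤ j then 1 else 0

/-- The root `α'_{i,j} = α_0 + v(α_1 + ⋯ + α_{i-1}) + v⁻¹(α_{j+1} + ⋯ + α_n)` in coordinates. -/
noncomputable def alphaIJ' (n : ℕ) (v : ℝ) (i j : ℕ) : Fin (n + 1) → ℝ :=
  fun l => if (l : ℕ) = 0 then 1
    else if (l : ℕ) < i then v
    else if j < (l : ℕ) then v⁻¹
    else 0

/-- `Φ_{i,j}(n,v) = { η v^m (c_{k+1} α_{i,j} + c_k α'_{i,j}) | η = ±1, m, k ∈ ℤ }`. -/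
noncomputable def PhiIJ (n : ℕ) (v : ℝ) (i j : ℕ) : Set (Fin (n + 1) → ℝ) :=
  { x | ∃ (η : ℝ) (m k : ℤ), (η = 1 ∨ η = -1) ∧
      x = (η * v ^ m) • (qint v (k + 1) • alphaIJ n i j + qint v k • alphaIJ' n v i j) }

/-- The realized root system `Φ(n,v)` of affine type `Ã_n` with parameter `v`. -/
noncomputable def Phi (n : ℕ) (v : ℝ) : Set (Fin (n + 1) → ℝ) :=
  ⋃ (i : ℕ) (j : ℕ) (_ : 1 ≤ i) (_ : i ≤ j) (_ : j ≤ n), PhiIJ n v i j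

/-- The determinant of the square matrix whose `l`-th column is `γ l`. -/
noncomputable def detCols {n : ℕ} (γ : Fin n → Fin n → ℝ) : ℝ :=
  Matrix.det (Matrix.of fun i l => γ l i)

theorem qint_zero_aux (v : ℝ) : qint v 0 = 0 := by simp [qint]

theorem qint_one_aux (v : ℝ) (hv : 0 < v) : qint v 1 = 1 := by
  unfold qint
  split_ifs with h
  · simp
  · have h2 : v - v⁻¹ ≠ 0 := by
      intro h3
      apply h
      field_simp at h3
      nlinarith
    simp [div_self h2]

theorem qint_neg_one_aux (v : ℝ) (hv : 0 < v) : qint v (-1) = -1 := by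
  have h := qint_one_aux v hv
  unfold qint at h ⊢
  split_ifs with h1
  · simp
  · rw [if_neg h1] at h
    rw [← h, neg_neg, ← neg_div, neg_sub]

theorem alphaIJ_mem_aux (n : ℕ) (v : ℝ) (hv : 0 < v) (i j : ℕ) (h1 : 1 ≤ i) (h2 : i ≤ j)
    (h3 : j ≤ n) : alphaIJ n i j ∈ Phi n v := by
  simp only [Phi, Set.mem_iUnion]
  refine ⟨i, j, h1, h2, h3, 1, 0, 0, Or.inl rfl, ?_⟩
  simp [qint_zero_aux, qint_one_aux v hv]

theorem alphaIJ'_mem_aux (n : ℕ) (v : ℝ) (hv : 0 < v) (i j : ℕ) (h1 : 1 ≤ i) (h2 : i ≤ j)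
    (h3 : j ≤ n) : alphaIJ' n v i j ∈ Phi n v := by
  simp only [Phi, Set.mem_iUnion]
  refine ⟨i, j, h1, h2, h3, -1, 0, -1, Or.inr rfl, ?_⟩
  simp [qint_zero_aux, qint_neg_one_aux v hv]

theorem det_one_updateCol_aux {m : ℕ} (i : Fin m) (b : Fin m → ℝ) :
    ((1 : Matrix (Fin m) (Fin m) ℝ).updateCol i b).det = b i := by
  rw [← Matrix.cramer_apply, Matrix.cramer_one]; rfl

theorem det_two_aux {m : ℕ} (p q : Fin m) (hpq : p ≠ q) (a b : Fin m → ℝ)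
    (ha : a p = 1) (hb : b p = 1) :
    (((1 : Matrix (Fin m) (Fin m) ℝ).updateCol p a).updateCol q b).det = b q - a q := by
  set A := (1 : Matrix (Fin m) (Fin m) ℝ).updateCol p a with hA
  have hdet : A.det = 1 := by rw [hA, det_one_updateCol_aux, ha]
  have hbA : b = A.mulVec (b - a + Pi.single p 1) := by
    have e1 : A.mulVec (Pi.single p 1) = a := by
      ext i; simp [hA]
    have e2 : A.mulVec (b - a) = b - a := by
      ext i
      have : ∀ j, A i j * (b - a) j = (1 : Matrix (Fin m) (Fin m) ℝ) i j * (b - a) j := by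
        intro j
        by_cases hj : j = p
        · subst hj; simp [ha, hb]
        · simp [hA, Matrix.updateCol_apply, hj]
      simp only [Matrix.mulVec, dotProduct, this]
      simp [Matrix.one_apply]
    rw [Matrix.mulVec_add, e1, e2]; simp
  rw [← Matrix.cramer_apply]
  conv_lhs => rw [hbA]
  rw [Matrix.cramer_eq_adjugate_mulVec, Matrix.mulVec_mulVec, Matrix.adjugate_mul, hdet]
  simp [hpq.symm]

/-- for `n ≥ 3` there exist roots `γ_0, …, γ_n ∈ Φ(n,v)` with
`det(γ_0, …, γ_n) = v - v⁻¹`. -/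
theorem exists_det_eq (n : ℕ) (hn : 3 ≤ n) (v : ℝ) (hv : 0 < v) :
    ∃ γ : Fin (n + 1) → Fin (n + 1) → ℝ,
      (∀ l, γ l ∈ Phi n v) ∧ detCols γ = v - v⁻¹ := by
  let p : Fin (n + 1) := ⟨0, by omega⟩
  let q : Fin (n + 1) := ⟨2, by omega⟩
  have hpq : p ≠ q := by simp [p, q]
  refine ⟨fun l => if l = q then alphaIJ' n v 3 3 else if l = p then alphaIJ' n v 1 1
    else alphaIJ n l l, ?_, ?_⟩
  · intro l
    dsimp only
    split_ifs with h1 h2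
    · exact alphaIJ'_mem_aux n v hv 3 3 (by omega) le_rfl hn
    · exact alphaIJ'_mem_aux n v hv 1 1 (by omega) le_rfl (by omega)
    · refine alphaIJ_mem_aux n v hv l l ?_ le_rfl (by omega)
      have : (l : ℕ) ≠ 0 := fun h => h2 (Fin.ext h)
      omega
  · have key := det_two_aux p q hpq (alphaIJ' n v 1 1) (alphaIJ' n v 3 3)
      (by simp [alphaIJ', p]) (by simp [alphaIJ', p])
    have hq : alphaIJ' n v 3 3 q - alphaIJ' n v 1 1 q = v - v⁻¹ := by
      simp [alphaIJ', q]
    rw [← hq, ← key, detCols]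
    congr 1
    ext i l
    simp only [Matrix.of_apply, Matrix.updateCol_apply]
    split_ifs with h1 h2
    · rfl
    · rfl
    · simp only [alphaIJ, Matrix.one_apply]
      congr 1
      rw [Fin.ext_iff, eq_iff_iff]
      omega
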